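/- If α_th ≤ α < n/2, then the high-SNR asymptotic capacity satisfies lim_{A→∞} ( C_{h,σ²}(A, αA) − log A ) = (1/2)·log( s_n² / (2π e σ²) ). -/

import Mathlib

open MeasureTheory ProbabilityTheory Real Filter
open scoped NNReal ENNReal Classical

noncomputable section

/-- Kullback–Leibler divergence (Mathlib's `ProbabilityTheory.klDiv`). -/
def klDiv {α : Type*} [MeasurableSpace α] (μ ν : Measure α) : EReal :=
  if μ ≪ ν ∧ Integrable (llr μ ν) μ then ((∫ x, llr μ ν x ∂μ : ℝ) : EReal) else ⊤

/-- Mutual information of a joint law: KL divergence of the joint law from the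
product of its marginals. -/
def mutualInfo {α β : Type*} [MeasurableSpace α] [MeasurableSpace β]
    (joint : Measure (α × β)) : EReal :=
  klDiv joint ((joint.map Prod.fst).prod (joint.map Prod.snd))

/-- Partial sums `s_k = h_1 + ⋯ + h_k`. -/
def sCum {n : ℕ} (h : Fin n → ℝ) (k : ℕ) : ℝ :=
  ∑ i : Fin n, if i.val < k then h i else 0

/-- Joint law of `(X, Y)` with `Y = hᵀX + Z`, `Z ~ N(0, v)` independent of `X`. -/
def misoJoint {n : ℕ} (h : Fin n → ℝ) (v : ℝ≥0) (μ : Measure (Fin n → ℝ)) :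
    Measure ((Fin n → ℝ) × ℝ) :=
  (μ.prod (gaussianReal 0 v)).map (fun p => (p.1, (∑ k, h k * p.1 k) + p.2))

/-- MISO capacity under peak-power constraint `A` and average-power constraint `E`. -/
def misoCapacity {n : ℕ} (h : Fin n → ℝ) (v : ℝ≥0) (A E : ℝ) : EReal :=
  ⨆ μ ∈ {μ : Measure (Fin n → ℝ) | IsProbabilityMeasure μ ∧
      (∀ k, ∀ᵐ x ∂μ, x k ∈ Set.Icc 0 A) ∧ (∑ k, ∫ x, x k ∂μ) ≤ E},
    mutualInfo (misoJoint h v μ)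

/-- MISO capacity under only an average-power constraint `E`. -/
def misoCapacityAvg {n : ℕ} (h : Fin n → ℝ) (v : ℝ≥0) (E : ℝ) : EReal :=
  ⨆ μ ∈ {μ : Measure (Fin n → ℝ) | IsProbabilityMeasure μ ∧
      (∀ k, ∀ᵐ x ∂μ, 0 ≤ x k) ∧ (∑ k, ∫ x, x k ∂μ) ≤ E},
    mutualInfo (misoJoint h v μ)

/-- Joint law of `(X̄, X̄ + Z)` for the unit-gain SISO channel. -/
def sisoJoint (v : ℝ≥0) (μ : Measure ℝ) : Measure (ℝ × ℝ) :=
  (μ.prod (gaussianReal 0 v)).map (fun p => (p.1, p.1 + p.2))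

/-- Unit-gain SISO capacity under peak-power constraint `A` and average-power
constraint `E`. -/
def sisoCapacity (v : ℝ≥0) (A E : ℝ) : EReal :=
  ⨆ μ ∈ {μ : Measure ℝ | IsProbabilityMeasure μ ∧
      (∀ᵐ x ∂μ, x ∈ Set.Icc 0 A) ∧ (∫ x, x ∂μ) ≤ E},
    mutualInfo (sisoJoint v μ)

/-- Unit-gain SISO capacity under only an average-power constraint `E`. -/
def sisoCapacityAvg (v : ℝ≥0) (E : ℝ) : EReal :=
  ⨆ μ ∈ {μ : Measure ℝ | IsProbabilityMeasure μ ∧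
      (∀ᵐ x ∂μ, 0 ≤ x) ∧ (∫ x, x ∂μ) ≤ E},
    mutualInfo (sisoJoint v μ)

/-- The interval `(s_{k-1} A, s_k A]` (with the first one being `[0, s_1 A]`)
corresponding to the event `U = k` (0-indexed: `k ∈ Fin n` stands for `k+1`). -/
def uInterval {n : ℕ} (h : Fin n → ℝ) (A : ℝ) (k : Fin n) : Set ℝ :=
  if k.val = 0 then Set.Icc 0 (sCum h 1 * A)
  else Set.Ioc (sCum h k.val * A) (sCum h (k.val + 1) * A)

/-- The average input power `∑_k p_k ((E[X̄ | U=k] - A s_{k-1})/h_k + (k-1) A)`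
consumed to generate a scalar law of `X̄`. -/
def avgPowerUse {n : ℕ} (h : Fin n → ℝ) (A : ℝ) (μ : Measure ℝ) : ℝ :=
  ∑ k : Fin n,
    (((∫ x in uInterval h A k, x ∂μ) - A * sCum h k.val * (μ (uInterval h A k)).toReal) / h k
      + (k.val : ℝ) * A * (μ (uInterval h A k)).toReal)

/-- The threshold `α_th`. -/
def alphaTh {n : ℕ} (h : Fin n → ℝ) : ℝ :=
  1 / 2 + (1 / sCum h n) * ∑ k : Fin n, h k * (k.val : ℝ)


end

noncomputable section

section AdditiveNoise

variable {E : Type*} [MeasurableSpace E]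

/-- Joint law of `(X, T X + Z)` for `X ∼ μ` and an independent `Z ∼ N(0, v)`. -/
def additiveJoint (T : E → ℝ) (v : ℝ≥0) (μ : Measure E) : Measure (E × ℝ) :=
  (μ.prod (gaussianReal 0 v)).map (fun p => (p.1, T p.1 + p.2))

/-- Density of `T X + Z` for `X ∼ μ` and an independent `Z ∼ N(0, v)`. -/
def outputDensity (T : E → ℝ) (v : ℝ≥0) (μ : Measure E) (y : ℝ) : ℝ :=
  ∫ x, gaussianPDFReal 0 v (y - T x) ∂μ

lemma gaussianPDFReal_zero_le (v : ℝ≥0) (x : ℝ) :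
    gaussianPDFReal 0 v x ≤ (√(2 * π * v))⁻¹ := by
  rw [gaussianPDFReal]
  have h1 : rexp (-(x - 0) ^ 2 / (2 * v)) ≤ 1 :=
    Real.exp_le_one_iff.2 (div_nonpos_of_nonpos_of_nonneg (by nlinarith [sq_nonneg (x - 0)])
      (by positivity))
  exact mul_le_of_le_one_right (by positivity) h1

lemma log_gaussianPDFReal_zero {v : ℝ≥0} (hv : 0 < v) (x : ℝ) :
    log (gaussianPDFReal 0 v x) = -(1 / 2) * log (2 * π * v) - x ^ 2 / (2 * v) := by
  have hv' : (0 : ℝ) < v := hv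
  rw [gaussianPDFReal, Real.log_mul (by positivity) (by positivity), Real.log_inv, Real.log_exp,
    Real.log_sqrt (by positivity)]
  ring

lemma integrable_sq_gaussianReal (v : ℝ≥0) : Integrable (fun z => z ^ 2) (gaussianReal 0 v) :=
  (memLp_id_gaussianReal' 2 (by simp)).integrable_sq

lemma integrable_abs_gaussianReal (v : ℝ≥0) : Integrable (fun z => |z|) (gaussianReal 0 v) :=
  ((memLp_id_gaussianReal' 1 (by simp)).integrable le_rfl).abs

lemma integral_sq_gaussianReal (v : ℝ≥0) : ∫ z, z ^ 2 ∂gaussianReal 0 v = v := by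
  have h := variance_eq_sub (μ := gaussianReal 0 v) (X := id)
    (memLp_id_gaussianReal' 2 (by simp))
  rw [variance_id_gaussianReal] at h
  simpa using h.symm

lemma integrable_log_gaussianPDFReal {v : ℝ≥0} (hv : 0 < v) :
    Integrable (fun z => log (gaussianPDFReal 0 v z)) (gaussianReal 0 v) := by
  simp_rw [log_gaussianPDFReal_zero hv]
  exact (integrable_const _).sub ((integrable_sq_gaussianReal v).div_const _)

lemma integral_log_gaussianPDFReal {v : ℝ≥0} (hv : 0 < v) :
    ∫ z, log (gaussianPDFReal 0 v z) ∂gaussianReal 0 v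
      = -(1 / 2) * log (2 * π * rexp 1 * v) := by
  have hv' : (0 : ℝ) < v := hv
  simp_rw [log_gaussianPDFReal_zero hv]
  rw [integral_sub (integrable_const _) ((integrable_sq_gaussianReal v).div_const _),
    integral_div, integral_sq_gaussianReal]
  have : 2 * π * rexp 1 * v = 2 * π * v * rexp 1 := by ring
  simp only [integral_const, probReal_univ, smul_eq_mul, one_mul]
  rw [this, Real.log_mul (x := 2 * π * v) (by positivity) (by positivity), Real.log_exp]
  field_simp
  ring

lemma measurable_outputDensity {T : E → ℝ} (hT : Measurable T) (v : ℝ≥0)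
    (μ : Measure E) [SFinite μ] : Measurable (outputDensity T v μ) := by
  have h : StronglyMeasurable (fun p : ℝ × E => gaussianPDFReal 0 v (p.1 - T p.2)) :=
    ((measurable_gaussianPDFReal 0 v).comp (by fun_prop)).stronglyMeasurable
  exact h.integral_prod_right.measurable

lemma integrable_gaussianPDFReal_sub {T : E → ℝ} (hT : Measurable T) (v : ℝ≥0)
    (μ : Measure E) [IsFiniteMeasure μ] (y : ℝ) :
    Integrable (fun x => gaussianPDFReal 0 v (y - T x)) μ := by
  refine Integrable.of_bound
    ((measurable_gaussianPDFReal 0 v).comp (by fun_prop)).aestronglyMeasurable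
    (√(2 * π * v))⁻¹ (.of_forall fun x => ?_)
  rw [Real.norm_of_nonneg (gaussianPDFReal_nonneg _ _ _)]
  exact gaussianPDFReal_zero_le v _

lemma additiveJoint_eq_withDensity {T : E → ℝ} (hT : Measurable T) {v : ℝ≥0} (hv : 0 < v)
    (μ : Measure E) [IsProbabilityMeasure μ] :
    additiveJoint T v μ = (μ.prod volume).withDensity
      (fun p => ENNReal.ofReal (gaussianPDFReal 0 v (p.2 - T p.1))) := by
  have hmp : MeasurePreserving (fun p : E × ℝ => (p.1, T p.1 + p.2))
      (μ.prod volume) (μ.prod volume) :=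
    (MeasurePreserving.id μ).skew_product (g := fun x z => T x + z)
      (by simp only [Function.uncurry_def]; fun_prop)
      (.of_forall fun x => map_add_left_eq_self _ _)
  have hm : Measurable fun p : E × ℝ => ENNReal.ofReal (gaussianPDFReal 0 v (p.2 - T p.1)) :=
    ((measurable_gaussianPDFReal 0 v).comp (by fun_prop)).ennreal_ofReal
  ext s hs
  rw [additiveJoint, gaussianReal_of_var_ne_zero 0 hv.ne',
    prod_withDensity_right (measurable_gaussianPDF 0 v),
    Measure.map_apply hmp.measurable hs, withDensity_apply _ (hmp.measurable hs),
    withDensity_apply _ hs, ← hmp.setLIntegral_comp_preimage hs hm]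
  simp [gaussianPDF]

lemma additiveJoint_map_fst {T : E → ℝ} (hT : Measurable T) (v : ℝ≥0)
    (μ : Measure E) [IsProbabilityMeasure μ] : (additiveJoint T v μ).map Prod.fst = μ := by
  rw [additiveJoint, Measure.map_map measurable_fst (by fun_prop)]
  exact measurePreserving_fst.map_eq

lemma additiveJoint_map_snd {T : E → ℝ} (hT : Measurable T) {v : ℝ≥0} (hv : 0 < v)
    (μ : Measure E) [IsProbabilityMeasure μ] :
    (additiveJoint T v μ).map Prod.snd
      = volume.withDensity fun y => ENNReal.ofReal (outputDensity T v μ y) := by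
  have hm : Measurable fun p : E × ℝ => ENNReal.ofReal (gaussianPDFReal 0 v (p.2 - T p.1)) :=
    ((measurable_gaussianPDFReal 0 v).comp (by fun_prop)).ennreal_ofReal
  ext s hs
  rw [Measure.map_apply measurable_snd hs, additiveJoint_eq_withDensity hT hv,
    withDensity_apply _ (measurable_snd hs), withDensity_apply _ hs, ← Set.univ_prod,
    ← Measure.prod_restrict, lintegral_prod_symm _ hm.aemeasurable]
  refine lintegral_congr fun y => ?_
  rw [Measure.restrict_univ, outputDensity,
    ofReal_integral_eq_lintegral_ofReal (integrable_gaussianPDFReal_sub hT v μ y)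
      (.of_forall fun x => gaussianPDFReal_nonneg _ _ _)]

lemma map_add_prod_gaussianReal {T : E → ℝ} (hT : Measurable T) {v : ℝ≥0} (hv : 0 < v)
    (μ : Measure E) [IsProbabilityMeasure μ] :
    (μ.prod (gaussianReal 0 v)).map (fun p => T p.1 + p.2)
      = volume.withDensity fun y => ENNReal.ofReal (outputDensity T v μ y) := by
  rw [← additiveJoint_map_snd hT hv, additiveJoint, Measure.map_map measurable_snd (by fun_prop)]
  rfl

lemma outputDensity_le {T : E → ℝ} (hT : Measurable T) (v : ℝ≥0)
    (μ : Measure E) [IsProbabilityMeasure μ] (y : ℝ) :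
    outputDensity T v μ y ≤ (√(2 * π * v))⁻¹ := by
  have := integral_mono (integrable_gaussianPDFReal_sub hT v μ y) (integrable_const _)
    (fun x => gaussianPDFReal_zero_le v (y - T x))
  simpa [outputDensity] using this

lemma le_outputDensity {T : E → ℝ} (hT : Measurable T) (v : ℝ≥0)
    (μ : Measure E) [IsProbabilityMeasure μ] {L : ℝ} (hTL : ∀ᵐ x ∂μ, T x ∈ Set.Icc 0 L) (y : ℝ) :
    gaussianPDFReal 0 v (|y| + L) ≤ outputDensity T v μ y := by
  have : ∫ _, gaussianPDFReal 0 v (|y| + L) ∂μ ≤ outputDensity T v μ y := by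
    refine integral_mono_ae (integrable_const _) (integrable_gaussianPDFReal_sub hT v μ y) ?_
    filter_upwards [hTL] with x hx
    simp only [gaussianPDFReal, sub_zero]
    have h1 : |y - T x| ≤ |(|y| + L)| := by
      rw [abs_of_nonneg (a := |y| + L) (by linarith [abs_nonneg y, hx.1, hx.2])]
      exact (abs_sub _ _).trans (by rw [abs_of_nonneg hx.1]; linarith [hx.2])
    have h2 := sq_le_sq.2 h1
    exact mul_le_mul_of_nonneg_left (Real.exp_le_exp.2
      (div_le_div_of_nonneg_right (neg_le_neg h2) (by positivity))) (by positivity)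
  simpa using this

lemma outputDensity_pos {T : E → ℝ} (hT : Measurable T) {v : ℝ≥0} (hv : 0 < v)
    (μ : Measure E) [IsProbabilityMeasure μ] {L : ℝ} (hTL : ∀ᵐ x ∂μ, T x ∈ Set.Icc 0 L) (y : ℝ) :
    0 < outputDensity T v μ y :=
  (gaussianPDFReal_pos 0 v _ hv.ne').trans_le (le_outputDensity hT v μ hTL y)

lemma ae_prod_gaussianReal_mem (v : ℝ≥0) {T : E → ℝ} {μ : Measure E} [IsProbabilityMeasure μ]
    {L : ℝ} (hTL : ∀ᵐ x ∂μ, T x ∈ Set.Icc 0 L) :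
    ∀ᵐ p ∂μ.prod (gaussianReal 0 v), T p.1 ∈ Set.Icc 0 L :=
  Measure.quasiMeasurePreserving_fst.ae hTL

lemma integrable_log_outputDensity {T : E → ℝ} (hT : Measurable T) {v : ℝ≥0} (hv : 0 < v)
    (μ : Measure E) [IsProbabilityMeasure μ] {L : ℝ} (hTL : ∀ᵐ x ∂μ, T x ∈ Set.Icc 0 L) :
    Integrable (fun p : E × ℝ => log (outputDensity T v μ (T p.1 + p.2)))
      (μ.prod (gaussianReal 0 v)) := by
  have hv' : (0 : ℝ) < v := hv
  have hg : Integrable (fun z : ℝ => |log (√(2 * π * v))⁻¹| + |(-(1 / 2) * log (2 * π * v))|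
      + (8 * L ^ 2 + 2 * z ^ 2) / (2 * v)) (gaussianReal 0 v) :=
    (integrable_const _).add
      (((integrable_const _).add ((integrable_sq_gaussianReal v).const_mul 2)).div_const _)
  refine (hg.comp_snd μ).mono' ?_ ?_
  · exact (Real.measurable_log.comp
      ((measurable_outputDensity hT v μ).comp (by fun_prop))).aestronglyMeasurable
  · filter_upwards [ae_prod_gaussianReal_mem v hTL] with p hp
    have h1 := Real.log_le_log (outputDensity_pos hT hv μ hTL (T p.1 + p.2))
      (outputDensity_le hT v μ (T p.1 + p.2))
    have h2 := Real.log_le_log (gaussianPDFReal_pos 0 v _ hv.ne')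
      (le_outputDensity hT v μ hTL (T p.1 + p.2))
    rw [log_gaussianPDFReal_zero hv] at h2
    have h3 : (|T p.1 + p.2| + L) ^ 2 ≤ 8 * L ^ 2 + 2 * p.2 ^ 2 := by
      have h4 : |T p.1 + p.2| ≤ L + |p.2| :=
        (abs_add_le _ _).trans (by rw [abs_of_nonneg hp.1]; linarith [hp.2])
      have h5 : 0 ≤ L := hp.1.trans hp.2
      have h6 : (|T p.1 + p.2| + L) ^ 2 ≤ (2 * L + |p.2|) ^ 2 :=
        pow_le_pow_left₀ (by positivity) (by linarith) 2
      nlinarith [sq_abs p.2, sq_nonneg (2 * L - |p.2|)]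
    have h4 : (|T p.1 + p.2| + L) ^ 2 / (2 * v) ≤ (8 * L ^ 2 + 2 * p.2 ^ 2) / (2 * v) := by gcongr
    have h5 : 0 ≤ (|T p.1 + p.2| + L) ^ 2 / (2 * v) := by positivity
    rw [Real.norm_eq_abs, abs_le]
    have h7 := le_abs_self (log (√(2 * π * v))⁻¹)
    have h8 := neg_abs_le (-(1 / 2) * log (2 * π * v))
    have h9 := abs_nonneg (log (√(2 * π * v))⁻¹)
    have h10 := abs_nonneg (-(1 / 2) * log (2 * π * v))
    constructor <;> linarith

lemma mutualInfo_additiveJoint {T : E → ℝ} (hT : Measurable T) {v : ℝ≥0} (hv : 0 < v)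
    (μ : Measure E) [IsProbabilityMeasure μ] {L : ℝ} (hTL : ∀ᵐ x ∂μ, T x ∈ Set.Icc 0 L) :
    mutualInfo (additiveJoint T v μ)
      = ((-(1 / 2) * log (2 * π * rexp 1 * v)
        - ∫ p, log (outputDensity T v μ (T p.1 + p.2)) ∂μ.prod (gaussianReal 0 v) : ℝ) :
          EReal) := by
  set f := outputDensity T v μ with hf
  set ν := μ.prod ((additiveJoint T v μ).map Prod.snd) with hν
  have hfpos : ∀ y, 0 < f y := outputDensity_pos hT hv μ hTL
  have hfm : Measurable f := measurable_outputDensity hT v μ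
  have hgm : Measurable fun p : E × ℝ => gaussianPDFReal 0 v (p.2 - T p.1) :=
    (measurable_gaussianPDFReal 0 v).comp (by fun_prop)
  have hmap : Measurable fun p : E × ℝ => (p.1, T p.1 + p.2) := by fun_prop
  have hJprob : IsProbabilityMeasure (additiveJoint T v μ) :=
    Measure.isProbabilityMeasure_map hmap.aemeasurable
  have hPprob : IsProbabilityMeasure ((additiveJoint T v μ).map Prod.snd) :=
    Measure.isProbabilityMeasure_map measurable_snd.aemeasurable
  have hνd : ν = (μ.prod volume).withDensity (fun p => ENNReal.ofReal (f p.2)) := by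
    rw [hν, additiveJoint_map_snd hT hv, prod_withDensity_right hfm.ennreal_ofReal]
  have hqm : Measurable fun p : E × ℝ =>
      ENNReal.ofReal (gaussianPDFReal 0 v (p.2 - T p.1) / f p.2) :=
    (hgm.div (hfm.comp measurable_snd)).ennreal_ofReal
  have hJ : additiveJoint T v μ = ν.withDensity
      (fun p => ENNReal.ofReal (gaussianPDFReal 0 v (p.2 - T p.1) / f p.2)) := by
    have hfm2 : Measurable fun p : E × ℝ => ENNReal.ofReal (f p.2) :=
      (hfm.comp measurable_snd).ennreal_ofReal
    rw [hνd, ← withDensity_mul _ hfm2 hqm,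
      additiveJoint_eq_withDensity hT hv]
    congr 1
    ext p
    rw [Pi.mul_apply, ← ENNReal.ofReal_mul (hfpos _).le, mul_div_cancel₀ _ (hfpos _).ne']
  have hac : additiveJoint T v μ ≪ ν := by
    rw [hJ]; exact withDensity_absolutelyContinuous _ _
  have hllr : llr (additiveJoint T v μ) ν =ᵐ[additiveJoint T v μ]
      fun p => log (gaussianPDFReal 0 v (p.2 - T p.1)) - log (f p.2) := by
    refine hac.ae_le ?_
    have h := Measure.rnDeriv_withDensity ν hqm
    rw [← hJ] at h
    filter_upwards [h] with p hp
    have hg := gaussianPDFReal_pos 0 v (p.2 - T p.1) hv.ne'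
    rw [llr, hp, ENNReal.toReal_ofReal (div_pos hg (hfpos _)).le,
      Real.log_div hg.ne' (hfpos _).ne']
  have hFm : Measurable fun p : E × ℝ =>
      log (gaussianPDFReal 0 v (p.2 - T p.1)) - log (f p.2) :=
    (Real.measurable_log.comp hgm).sub (Real.measurable_log.comp (hfm.comp measurable_snd))
  have h1 : Integrable (fun p : E × ℝ => log (gaussianPDFReal 0 v p.2))
      (μ.prod (gaussianReal 0 v)) := (integrable_log_gaussianPDFReal hv).comp_snd μ
  have h2 := integrable_log_outputDensity hT hv μ hTL
  have hint : Integrable (fun p => log (gaussianPDFReal 0 v (p.2 - T p.1)) - log (f p.2))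
      (additiveJoint T v μ) := by
    rw [additiveJoint, integrable_map_measure hFm.aestronglyMeasurable hmap.aemeasurable]
    exact (h1.sub h2).congr (.of_forall fun p => by simp [hf])
  rw [mutualInfo, additiveJoint_map_fst hT, klDiv, if_pos ⟨hac, hint.congr hllr.symm⟩,
    integral_congr_ae hllr, additiveJoint, integral_map hmap.aemeasurable hFm.aestronglyMeasurable]
  simp only [add_sub_cancel_left]
  rw [integral_sub h1 h2, integral_fun_snd (fun z => log (gaussianPDFReal 0 v z)),
    integral_log_gaussianPDFReal hv]
  simp [hf]

/-- Gibbs' inequality for the output law. -/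
lemma integral_log_le_integral_log_outputDensity {T : E → ℝ} (hT : Measurable T) {v : ℝ≥0}
    (hv : 0 < v) (μ : Measure E) [IsProbabilityMeasure μ] {L : ℝ}
    (hTL : ∀ᵐ x ∂μ, T x ∈ Set.Icc 0 L) {r : ℝ → ℝ} (hr : Measurable r) (hrpos : ∀ y, 0 < r y)
    (hrint : Integrable r) (hr1 : ∫ y, r y ≤ 1)
    (hlog : Integrable (fun p : E × ℝ => log (r (T p.1 + p.2))) (μ.prod (gaussianReal 0 v))) :
    ∫ p, log (r (T p.1 + p.2)) ∂μ.prod (gaussianReal 0 v)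
      ≤ ∫ p, log (outputDensity T v μ (T p.1 + p.2)) ∂μ.prod (gaussianReal 0 v) := by
  set f := outputDensity T v μ with hf
  have hfpos : ∀ y, 0 < f y := outputDensity_pos hT hv μ hTL
  have hfm : Measurable f := measurable_outputDensity hT v μ
  have hmul : (fun y => (ENNReal.ofReal (f y)).toReal • (r y / f y)) = r := by
    ext y
    rw [ENNReal.toReal_ofReal (hfpos y).le, smul_eq_mul, mul_div_cancel₀ _ (hfpos y).ne']
  have hq : Integrable (fun y => r y / f y)
      ((μ.prod (gaussianReal 0 v)).map (fun p => T p.1 + p.2)) := by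
    rw [map_add_prod_gaussianReal hT hv,
      integrable_withDensity_iff_integrable_smul' hfm.ennreal_ofReal (by simp), hmul]
    exact hrint
  have hadd : Measurable fun p : E × ℝ => T p.1 + p.2 := by fun_prop
  have hqm : Measurable fun y => r y / f y := hr.div hfm
  have hq' : Integrable (fun p : E × ℝ => r (T p.1 + p.2) / f (T p.1 + p.2))
      (μ.prod (gaussianReal 0 v)) :=
    (integrable_map_measure hqm.aestronglyMeasurable hadd.aemeasurable).1 hq
  have hqi : ∫ p, r (T p.1 + p.2) / f (T p.1 + p.2) ∂μ.prod (gaussianReal 0 v) ≤ 1 := by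
    rw [← integral_map (f := fun y => r y / f y) hadd.aemeasurable hqm.aestronglyMeasurable,
      map_add_prod_gaussianReal hT hv,
      integral_withDensity_eq_integral_toReal_smul hfm.ennreal_ofReal (by simp), hmul]
    exact hr1
  have hlf := integrable_log_outputDensity hT hv μ hTL
  have hmono : ∫ p, (log (r (T p.1 + p.2)) - log (f (T p.1 + p.2))) ∂μ.prod (gaussianReal 0 v)
      ≤ ∫ p, (r (T p.1 + p.2) / f (T p.1 + p.2) - 1) ∂μ.prod (gaussianReal 0 v) := by
    refine integral_mono (hlog.sub hlf) (hq'.sub (integrable_const _)) fun p => ?_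
    dsimp only
    rw [← Real.log_div (hrpos _).ne' (hfpos _).ne']
    exact Real.log_le_sub_one_of_pos (div_pos (hrpos _) (hfpos _))
  rw [integral_sub hlog hlf, integral_sub hq' (integrable_const _)] at hmono
  simp only [integral_const, probReal_univ, smul_eq_mul, one_mul] at hmono
  linarith

/-- The distance from `y` to the interval `[0, L]`. -/
def distIcc (L y : ℝ) : ℝ := max 0 (max (-y) (y - L))

@[fun_prop]
lemma continuous_distIcc (L : ℝ) : Continuous (distIcc L) := by
  unfold distIcc; fun_prop

lemma distIcc_nonneg (L y : ℝ) : 0 ≤ distIcc L y := le_max_left _ _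

lemma distIcc_add_le {L t : ℝ} (ht : t ∈ Set.Icc 0 L) (z : ℝ) : distIcc L (t + z) ≤ |z| :=
  max_le (abs_nonneg z) (max_le (by linarith [neg_abs_le z, ht.1]) (by linarith [le_abs_self z, ht.2]))

lemma exp_distIcc_integral_le {L ε : ℝ} (hL : 0 ≤ L) (hε : 0 < ε) :
    Integrable (fun y => rexp (-(ε * distIcc L y))) ∧
      ∫ y, rexp (-(ε * distIcc L y)) ≤ L + 2 / ε := by
  have h1 : Integrable ((Set.Icc 0 L).indicator fun _ : ℝ => (1 : ℝ)) :=
    (integrable_indicator_iff measurableSet_Icc).2 (integrableOn_const (by simp))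
  have h2 : Integrable ((Set.Iic 0).indicator fun y : ℝ => rexp (ε * y)) :=
    (integrable_indicator_iff measurableSet_Iic).2 (integrableOn_exp_mul_Iic hε 0)
  have h3 : Integrable ((Set.Ioi L).indicator fun y : ℝ => rexp (ε * L) * rexp (-ε * y)) :=
    (integrable_indicator_iff measurableSet_Ioi).2
      ((integrableOn_exp_mul_Ioi (neg_lt_zero.2 hε) L).const_mul _)
  have hle : ∀ y, rexp (-(ε * distIcc L y)) ≤ (Set.Icc 0 L).indicator (fun _ : ℝ => (1 : ℝ)) y
      + (Set.Iic 0).indicator (fun y : ℝ => rexp (ε * y)) y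
      + (Set.Ioi L).indicator (fun y : ℝ => rexp (ε * L) * rexp (-ε * y)) y := by
    intro y
    have i1 : 0 ≤ (Set.Icc 0 L).indicator (fun _ : ℝ => (1 : ℝ)) y :=
      Set.indicator_nonneg (fun _ _ => zero_le_one) _
    have i2 : 0 ≤ (Set.Iic 0).indicator (fun y : ℝ => rexp (ε * y)) y :=
      Set.indicator_nonneg (fun _ _ => (Real.exp_pos _).le) _
    have i3 : 0 ≤ (Set.Ioi L).indicator (fun y : ℝ => rexp (ε * L) * rexp (-ε * y)) y :=
      Set.indicator_nonneg (fun _ _ => by positivity) _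
    rcases le_or_gt y 0 with hy | hy
    · rw [Set.indicator_of_mem (Set.mem_Iic.2 hy)] at i2 ⊢
      have : -y ≤ distIcc L y := (le_max_left _ _).trans (le_max_right _ _)
      have := Real.exp_le_exp.2 (show -(ε * distIcc L y) ≤ ε * y by nlinarith)
      linarith
    · rcases le_or_gt y L with hy' | hy'
      · rw [Set.indicator_of_mem (Set.mem_Icc.2 ⟨hy.le, hy'⟩)] at i1 ⊢
        have := Real.exp_le_one_iff.2 (neg_nonpos.2 (mul_nonneg hε.le (distIcc_nonneg L y)))
        linarith
      · rw [Set.indicator_of_mem (Set.mem_Ioi.2 hy')] at i3 ⊢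
        have h5 : y - L ≤ distIcc L y := (le_max_right _ _).trans (le_max_right _ _)
        have := Real.exp_le_exp.2 (show -(ε * distIcc L y) ≤ ε * L + -ε * y by nlinarith)
        rw [Real.exp_add] at this
        linarith
  have hint : Integrable (fun y => rexp (-(ε * distIcc L y))) := by
    refine ((h1.add h2).add h3).mono' (by fun_prop) (.of_forall fun y => ?_)
    rw [Real.norm_of_nonneg (Real.exp_pos _).le]
    exact hle y
  refine ⟨hint, ?_⟩
  have h := integral_mono hint ((h1.add h2).add h3) hle
  have e : ∫ y, ((Set.Icc 0 L).indicator (fun _ : ℝ => (1 : ℝ))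
      + (Set.Iic 0).indicator (fun y : ℝ => rexp (ε * y))
      + (Set.Ioi L).indicator (fun y : ℝ => rexp (ε * L) * rexp (-ε * y))) y = L + 2 / ε := by
    rw [integral_add' (h1.add h2) h3, integral_add' h1 h2, integral_indicator measurableSet_Icc,
      integral_indicator measurableSet_Iic, integral_indicator measurableSet_Ioi,
      integral_exp_mul_Iic hε, integral_const_mul, integral_exp_mul_Ioi (neg_lt_zero.2 hε)]
    have : rexp (ε * L) * rexp (-ε * L) = 1 := by rw [← Real.exp_add]; simp
    rw [mul_div_assoc', mul_neg, this]
    simp [hL]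
    ring
  exact h.trans e.le

/-- Duality upper bound on the mutual information of a noisy observation of `T X ∈ [0, L]`. -/
lemma mutualInfo_additiveJoint_le {T : E → ℝ} (hT : Measurable T) {v : ℝ≥0} (hv : 0 < v)
    (μ : Measure E) [IsProbabilityMeasure μ] {L ε : ℝ} (hL : 0 ≤ L) (hε : 0 < ε)
    (hTL : ∀ᵐ x ∂μ, T x ∈ Set.Icc 0 L) :
    mutualInfo (additiveJoint T v μ) ≤ ((-(1 / 2) * log (2 * π * rexp 1 * v)
      + (log (L + 2 / ε) + ε * ∫ z, |z| ∂gaussianReal 0 v) : ℝ) : EReal) := by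
  rw [mutualInfo_additiveJoint hT hv μ hTL, EReal.coe_le_coe_iff]
  obtain ⟨hint, hle⟩ := exp_distIcc_integral_le hL hε
  have hM : 0 < L + 2 / ε := by positivity
  have hlogr : ∀ y, log (rexp (-(ε * distIcc L y)) / (L + 2 / ε))
      = -(ε * distIcc L y) - log (L + 2 / ε) := fun y => by
    rw [Real.log_div (by positivity) hM.ne', Real.log_exp]
  have hbd : ∀ᵐ p ∂μ.prod (gaussianReal 0 v), distIcc L (T p.1 + p.2) ≤ |p.2| := by
    filter_upwards [ae_prod_gaussianReal_mem v hTL] with p hp using distIcc_add_le hp p.2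
  have habs : Integrable (fun p : E × ℝ => |p.2|) (μ.prod (gaussianReal 0 v)) :=
    (integrable_abs_gaussianReal v).comp_snd μ
  have hdist : Integrable (fun p : E × ℝ => distIcc L (T p.1 + p.2))
      (μ.prod (gaussianReal 0 v)) := by
    refine habs.mono' ?_ ?_
    · exact ((continuous_distIcc L).measurable.comp (by fun_prop)).aestronglyMeasurable
    · filter_upwards [hbd] with p hp
      rwa [Real.norm_of_nonneg (distIcc_nonneg _ _)]
  have hdist_le : ∫ p, distIcc L (T p.1 + p.2) ∂μ.prod (gaussianReal 0 v)
      ≤ ∫ z, |z| ∂gaussianReal 0 v := by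
    refine (integral_mono_ae hdist habs hbd).trans_eq ?_
    rw [integral_fun_snd (fun z => |z|)]
    simp
  have hneg : Integrable (fun p : E × ℝ => -(ε * distIcc L (T p.1 + p.2)))
      (μ.prod (gaussianReal 0 v)) := (hdist.const_mul ε).neg
  have hI : Integrable (fun p : E × ℝ => -(ε * distIcc L (T p.1 + p.2)) - log (L + 2 / ε))
      (μ.prod (gaussianReal 0 v)) := hneg.sub (integrable_const _)
  have h := integral_log_le_integral_log_outputDensity hT hv μ hTL
    (r := fun y => rexp (-(ε * distIcc L y)) / (L + 2 / ε))
    (by have := (continuous_distIcc L).measurable; fun_prop) (fun y => by positivity)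
    (hint.div_const _) (by rw [integral_div]; exact (div_le_one hM).2 hle)
    (by simpa only [hlogr] using hI)
  simp only [hlogr] at h
  rw [integral_sub hneg (integrable_const _), integral_neg, integral_const_mul] at h
  simp only [integral_const, probReal_univ, smul_eq_mul, one_mul] at h
  nlinarith [mul_le_mul_of_nonneg_left hdist_le hε.le]

/-- Lower bound on the mutual information when the output density is at most `1 / L`. -/
lemma le_mutualInfo_additiveJoint {T : E → ℝ} (hT : Measurable T) {v : ℝ≥0} (hv : 0 < v)
    (μ : Measure E) [IsProbabilityMeasure μ] {L : ℝ}
    (hTL : ∀ᵐ x ∂μ, T x ∈ Set.Icc 0 L) (hf : ∀ y, outputDensity T v μ y ≤ L⁻¹) :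
    ((-(1 / 2) * log (2 * π * rexp 1 * v) + log L : ℝ) : EReal)
      ≤ mutualInfo (additiveJoint T v μ) := by
  rw [mutualInfo_additiveJoint hT hv μ hTL, EReal.coe_le_coe_iff]
  have h := integral_mono (integrable_log_outputDensity hT hv μ hTL) (integrable_const (log L⁻¹))
    fun p => Real.log_le_log (outputDensity_pos hT hv μ hTL _) (hf (T p.1 + p.2))
  simp only [integral_const, probReal_univ, smul_eq_mul, one_mul, Real.log_inv] at h
  linarith

end AdditiveNoise

section InputConstruction

variable {n : ℕ} (h : Fin n → ℝ)

lemma sCum_zero : sCum h 0 = 0 := by simp [sCum]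

lemma sCum_self : sCum h n = ∑ i, h i := by simp [sCum]

lemma sCum_succ (k : Fin n) : sCum h (k.val + 1) = sCum h k.val + h k := by
  have : ∀ i : Fin n, (if i.val < k.val + 1 then h i else 0)
      = (if i.val < k.val then h i else 0) + if i = k then h i else 0 := by
    intro i
    by_cases h1 : i = k
    · subst h1; simp
    · have h2 : i.val ≠ k.val := fun h3 => h1 (Fin.ext h3)
      have h3 : i.val < k.val + 1 ↔ i.val < k.val := by omega
      simp [h1, h3]
  simp only [sCum, this, Finset.sum_add_distrib]
  simp

variable {h}

lemma sCum_mono (hpos : ∀ k, 0 < h k) {a b : ℕ} (hab : a ≤ b) : sCum h a ≤ sCum h b := by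
  refine Finset.sum_le_sum fun i _ => ?_
  have := (hpos i).le
  split_ifs <;> first | omega | simp

lemma sum_sCum_add_sum_mul (h : Fin n → ℝ) :
    ∑ k : Fin n, sCum h k.val + ∑ k : Fin n, h k * (k.val : ℝ) = ((n : ℝ) - 1) * sCum h n := by
  have e : ∑ k : Fin n, sCum h k.val = ∑ i : Fin n, ((n : ℝ) - 1 - i.val) * h i := by
    simp only [sCum]
    rw [Finset.sum_comm]
    refine Finset.sum_congr rfl fun i _ => ?_
    rw [← Finset.sum_filter, Finset.sum_const, nsmul_eq_mul]
    have hc : (Finset.univ.filter fun k : Fin n => i.val < k.val).card = n - 1 - i.val := by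
      have : (Finset.univ.filter fun k : Fin n => i.val < k.val) = Finset.Ioi i := by
        ext k; simp
      rw [this, Fin.card_Ioi]
    rw [hc, Nat.cast_sub (by omega), Nat.cast_sub (by omega)]
    simp
  rw [e, sCum_self, Finset.mul_sum, ← Finset.sum_add_distrib]
  exact Finset.sum_congr rfl fun i _ => by ring

/-- The input that fills the LEDs one after the other so that the noiseless output is
`A * sCum h n * u`. -/
def fillInput {n : ℕ} (h : Fin n → ℝ) (A u : ℝ) (k : Fin n) : ℝ :=
  A * ((min (sCum h n * u) (sCum h (k.val + 1)) - min (sCum h n * u) (sCum h k.val)) / h k)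

lemma continuous_fillInput (h : Fin n → ℝ) (A : ℝ) : Continuous (fillInput h A) := by
  unfold fillInput; fun_prop

lemma fillInput_mem (hpos : ∀ k, 0 < h k) {A : ℝ} (hA : 0 ≤ A) (u : ℝ) (k : Fin n) :
    fillInput h A u k ∈ Set.Icc 0 A := by
  have h1 := sCum_succ h k
  have hk := hpos k
  have h2 : min (sCum h n * u) (sCum h k.val) ≤ min (sCum h n * u) (sCum h (k.val + 1)) :=
    min_le_min_left _ (by linarith)
  have h3 : min (sCum h n * u) (sCum h (k.val + 1)) ≤ min (sCum h n * u) (sCum h k.val) + h k := by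
    rw [h1, ← min_add_add_right]
    exact min_le_min_right _ (by linarith)
  refine ⟨mul_nonneg hA (div_nonneg (by linarith) hk.le),
    mul_le_of_le_one_right hA ((div_le_one hk).2 (by linarith))⟩

lemma sum_mul_fillInput (hpos : ∀ k, 0 < h k) (A : ℝ) {u : ℝ} (hu : u ∈ Set.Icc (0 : ℝ) 1) :
    ∑ k, h k * fillInput h A u k = A * sCum h n * u := by
  have h0 : 0 ≤ sCum h n := by simpa [sCum_zero] using sCum_mono hpos (Nat.zero_le n)
  have e : ∀ k : Fin n, h k * fillInput h A u k
      = A * (min (sCum h n * u) (sCum h (k.val + 1)) - min (sCum h n * u) (sCum h k.val)) :=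
    fun k => by
      have := (hpos k).ne'
      unfold fillInput; field_simp
  simp only [e]
  rw [← Finset.mul_sum, Fin.sum_univ_eq_sum_range
      (fun k => min (sCum h n * u) (sCum h (k + 1)) - min (sCum h n * u) (sCum h k)),
    Finset.sum_range_sub (fun k => min (sCum h n * u) (sCum h k)), sCum_zero,
    min_eq_left (mul_le_of_le_one_right h0 hu.2), min_eq_right (mul_nonneg h0 hu.1)]
  ring

lemma integral_min_mul {s c : ℝ} (hs : 0 < s) (hc : 0 ≤ c) (hcs : c ≤ s) :
    ∫ u in (0 : ℝ)..1, min (s * u) c = c - c ^ 2 / (2 * s) := by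
  have hi : ∀ a b : ℝ, IntervalIntegrable (fun u => min (s * u) c) volume a b :=
    fun a b => (by fun_prop : Continuous fun u => min (s * u) c).intervalIntegrable a b
  rw [← intervalIntegral.integral_add_adjacent_intervals (hi 0 (c / s)) (hi (c / s) 1)]
  have h1 : ∫ u in (0 : ℝ)..(c / s), min (s * u) c = ∫ u in (0 : ℝ)..(c / s), s * u := by
    refine intervalIntegral.integral_congr fun u hu => ?_
    rw [Set.uIcc_of_le (by positivity)] at hu
    have := (le_div_iff₀ hs).1 hu.2
    exact min_eq_left (by linarith)
  have h2 : ∫ u in (c / s)..1, min (s * u) c = ∫ _ in (c / s)..1, c := by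
    refine intervalIntegral.integral_congr fun u hu => ?_
    rw [Set.uIcc_of_le ((div_le_one hs).2 hcs)] at hu
    have := (div_le_iff₀ hs).1 hu.1
    exact min_eq_right (by linarith)
  rw [h1, h2, intervalIntegral.integral_const_mul, integral_id, intervalIntegral.integral_const,
    smul_eq_mul]
  field_simp
  ring

lemma integral_fillInput (hpos : ∀ k, 0 < h k) (A : ℝ) (k : Fin n) :
    ∫ u in (0 : ℝ)..1, fillInput h A u k
      = A * (1 - (2 * sCum h k.val + h k) / (2 * sCum h n)) := by
  have h1 := sCum_succ h k
  have hk := hpos k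
  have h0 : 0 ≤ sCum h k.val := by simpa [sCum_zero] using sCum_mono hpos (Nat.zero_le k.val)
  have hle : sCum h (k.val + 1) ≤ sCum h n := sCum_mono hpos k.isLt
  have hs : 0 < sCum h n := by linarith
  unfold fillInput
  rw [intervalIntegral.integral_const_mul, intervalIntegral.integral_div,
    intervalIntegral.integral_sub
      (Continuous.intervalIntegrable (by fun_prop) _ _)
      (Continuous.intervalIntegrable (by fun_prop) _ _),
    integral_min_mul hs (by linarith) hle, integral_min_mul hs h0 (by linarith), h1]
  field_simp
  ring

lemma sum_integral_fillInput (hpos : ∀ k, 0 < h k) (hs : 0 < sCum h n) (A : ℝ) :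
    ∑ k, ∫ u in (0 : ℝ)..1, fillInput h A u k = alphaTh h * A := by
  simp only [integral_fillInput hpos]
  have h1 := sum_sCum_add_sum_mul h
  rw [← Finset.mul_sum, Finset.sum_sub_distrib, ← Finset.sum_div, Finset.sum_add_distrib,
    ← Finset.mul_sum, ← sCum_self h, alphaTh, eq_sub_of_add_eq h1]
  simp only [Finset.sum_const, Finset.card_univ, Fintype.card_fin, nsmul_eq_mul]
  field_simp
  ring

lemma fillInput_output_le {v : ℝ≥0} (hv : 0 < v) {c : ℝ} (hc : 0 < c) (y : ℝ) :
    ∫ u in Set.Icc (0 : ℝ) 1, gaussianPDFReal 0 v (y - c * u) ≤ c⁻¹ := by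
  have hi : Integrable fun u => gaussianPDFReal 0 v (y - c * u) :=
    ((integrable_gaussianPDFReal 0 v).comp_sub_left y).comp_mul_left' hc.ne'
  refine (setIntegral_le_integral hi
    (.of_forall fun u => gaussianPDFReal_nonneg _ _ _)).trans_eq ?_
  rw [Measure.integral_comp_mul_left (fun t => gaussianPDFReal 0 v (y - t)),
    integral_sub_left_eq_self, integral_gaussianPDFReal_eq_one 0 hv.ne', abs_of_pos (by positivity)]
  simp

end InputConstruction

lemma misoCapacity_le {n : ℕ} {h : Fin n → ℝ} (hpos : ∀ k, 0 < h k) {v : ℝ≥0} (hv : 0 < v)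
    {A : ℝ} (hA : 0 ≤ A) {ε : ℝ} (hε : 0 < ε) (P : ℝ) :
    misoCapacity h v A P ≤ ((-(1 / 2) * log (2 * π * rexp 1 * v)
      + (log (sCum h n * A + 2 / ε) + ε * ∫ z, |z| ∂gaussianReal 0 v) : ℝ) : EReal) := by
  refine iSup₂_le fun μ hμ => ?_
  obtain ⟨hprob, hmem, -⟩ := hμ
  have hs : 0 ≤ sCum h n := by simpa [sCum_zero] using sCum_mono hpos (Nat.zero_le n)
  refine mutualInfo_additiveJoint_le (T := fun x : Fin n → ℝ => ∑ k, h k * x k) (by fun_prop) hv μ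
    (mul_nonneg hs hA) hε ?_
  filter_upwards [ae_all_iff.2 hmem] with x hx
  refine ⟨Finset.sum_nonneg fun k _ => mul_nonneg (hpos k).le (hx k).1, ?_⟩
  rw [sCum_self, Finset.sum_mul]
  exact Finset.sum_le_sum fun k _ => mul_le_mul_of_nonneg_left (hx k).2 (hpos k).le

lemma le_misoCapacity {n : ℕ} {h : Fin n → ℝ} (hpos : ∀ k, 0 < h k) (hs : 0 < sCum h n)
    {v : ℝ≥0} (hv : 0 < v) {A : ℝ} (hA : 0 < A) {α : ℝ} (hα : alphaTh h ≤ α) :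
    ((-(1 / 2) * log (2 * π * rexp 1 * v) + log (sCum h n * A) : ℝ) : EReal)
      ≤ misoCapacity h v A (α * A) := by
  have hm : Measurable (fillInput h A) := (continuous_fillInput h A).measurable
  have hU : IsProbabilityMeasure (volume.restrict (Set.Icc (0 : ℝ) 1)) := ⟨by simp⟩
  set μ := (volume.restrict (Set.Icc (0 : ℝ) 1)).map (fillInput h A) with hμ
  have hprob : IsProbabilityMeasure μ := Measure.isProbabilityMeasure_map hm.aemeasurable
  have hT : Measurable fun x : Fin n → ℝ => ∑ k, h k * x k := by fun_prop
  refine le_trans ?_ (le_iSup₂_of_le (f := fun μ _ => mutualInfo (misoJoint h v μ)) μ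
    ⟨hprob, fun k => ?_, ?_⟩ le_rfl)
  · refine le_mutualInfo_additiveJoint hT hv μ ?_ fun y => ?_
    · refine (ae_map_iff hm.aemeasurable (hT measurableSet_Icc)).2 ?_
      filter_upwards [ae_restrict_mem measurableSet_Icc] with u hu
      rw [sum_mul_fillInput hpos A hu, mul_comm A]
      have hsA : 0 ≤ sCum h n * A := by positivity
      exact ⟨mul_nonneg hsA hu.1, mul_le_of_le_one_right hsA hu.2⟩
    · have hg : Measurable fun x : Fin n → ℝ => gaussianPDFReal 0 v (y - ∑ k, h k * x k) :=
        (measurable_gaussianPDFReal 0 v).comp (by fun_prop)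
      rw [outputDensity, hμ, integral_map hm.aemeasurable hg.aestronglyMeasurable]
      refine le_trans (le_of_eq ?_) (fillInput_output_le hv (mul_pos hs hA) y)
      refine setIntegral_congr_fun measurableSet_Icc fun u hu => ?_
      simp only [sum_mul_fillInput hpos A hu, mul_comm A]
  · refine (ae_map_iff hm.aemeasurable (measurable_pi_apply k measurableSet_Icc)).2 ?_
    exact .of_forall fun u => fillInput_mem hpos hA.le u k
  · have e : ∀ k, ∫ x, x k ∂μ = ∫ u in (0 : ℝ)..1, fillInput h A u k := fun k => by
      rw [hμ, integral_map hm.aemeasurable (measurable_pi_apply k).aestronglyMeasurable,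
        intervalIntegral.integral_of_le zero_le_one, integral_Icc_eq_integral_Ioc]
    simp only [e, sum_integral_fillInput hpos hs]
    gcongr

end

theorem miso_capacity_high_snr_above_threshold (n : ℕ) (hn : 2 ≤ n) (h : Fin n → ℝ)
    (hord : ∀ i j : Fin n, i ≤ j → h j ≤ h i) (hpos : ∀ k, 0 < h k)
    (v : ℝ≥0) (hv : 0 < v)
    (α : ℝ) (hαth : alphaTh h ≤ α) (hαn : α < (n : ℝ) / 2) :
    Tendsto (fun A : ℝ => misoCapacity h v A (α * A) - ((Real.log A : ℝ) : EReal))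
      atTop
      (nhds ((1 / 2 * Real.log ((sCum h n) ^ 2 / (2 * π * Real.exp 1 * (v : ℝ))) : ℝ) : EReal)) := by
  have hs : 0 < sCum h n := by
    rw [sCum_self]
    exact Finset.sum_pos (fun k _ => hpos k) ⟨⟨0, by omega⟩, Finset.mem_univ _⟩
  have hv' : (0 : ℝ) < v := hv
  have hlim : 1 / 2 * Real.log ((sCum h n) ^ 2 / (2 * π * Real.exp 1 * (v : ℝ)))
      = -(1 / 2) * Real.log (2 * π * Real.exp 1 * v) + Real.log (sCum h n) := by
    rw [Real.log_div (by positivity) (by positivity), Real.log_pow]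
    push_cast
    ring
  rw [hlim]
  set c := -(1 / 2) * Real.log (2 * π * Real.exp 1 * v) with hc
  set m := ∫ z, |z| ∂gaussianReal 0 v with hm
  have hsqrt : Tendsto (fun A : ℝ => (√A)⁻¹) atTop (nhds 0) :=
    tendsto_inv_atTop_zero.comp Real.tendsto_sqrt_atTop
  have hupper : Tendsto (fun A : ℝ =>
      ((c + (Real.log (sCum h n + 2 * (√A)⁻¹) + (√A)⁻¹ * m) : ℝ) : EReal)) atTop
      (nhds ((c + Real.log (sCum h n) : ℝ) : EReal)) := by
    refine EReal.tendsto_coe.2 (Tendsto.const_add c ?_)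
    have h1 : Tendsto (fun A : ℝ => sCum h n + 2 * (√A)⁻¹) atTop (nhds (sCum h n)) := by
      simpa using (hsqrt.const_mul 2).const_add (sCum h n)
    simpa using (h1.log hs.ne').add (hsqrt.mul_const m)
  refine tendsto_of_tendsto_of_tendsto_of_le_of_le' tendsto_const_nhds hupper ?_ ?_
  · filter_upwards [eventually_gt_atTop 0] with A hA
    have h1 := EReal.sub_le_sub (le_misoCapacity hpos hs hv hA hαth)
      (le_refl ((Real.log A : ℝ) : EReal))
    rwa [← EReal.coe_sub, Real.log_mul hs.ne' hA.ne', ← add_assoc, add_sub_cancel_right] at h1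
  · filter_upwards [eventually_gt_atTop 0] with A hA
    have hr : 0 < √A := Real.sqrt_pos.2 hA
    have h1 := EReal.sub_le_sub (misoCapacity_le hpos hv hA.le (inv_pos.2 hr) (α * A))
      (le_refl ((Real.log A : ℝ) : EReal))
    rw [← EReal.coe_sub] at h1
    have h2 : sCum h n * A + 2 / (√A)⁻¹ = (sCum h n + 2 * (√A)⁻¹) * A := by
      have h3 := Real.mul_self_sqrt hA.le
      field_simp
      linear_combination 2 * h3
    rw [h2, Real.log_mul (by positivity) hA.ne'] at h1
    refine h1.trans_eq ?_
    congr 1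
    ring
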